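/- If the free deterministic max-product system x_{k+1} = A ⊠ x_k is exponentially stable, then the input–output system x_{k+1} = (A ⊠ x_k) ∨ (B ⊠ u_k), z_k = (C ⊠ x_k) ∨ (D ⊠ u_k) is BIBO stable: for every initial condition, if sup_{k≥0} ‖u_k‖ < ∞ then sup_{k≥0} ‖z_k‖ < ∞. -/

import Mathlib

open scoped NNReal

/-- Max-product of a matrix over ℝ₊ = [0,∞) with a vector:
`(A ⊠ x)_i = max_j A_{ij} x_j`. -/
noncomputable def mpMulVec {n m : ℕ} (A : Fin n → Fin m → ℝ≥0) (x : Fin m → ℝ≥0) :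
    Fin n → ℝ≥0 :=
  fun i => Finset.univ.sup fun j => A i j * x j

/-- Infinity norm of a nonnegative vector: `‖x‖ = max_i x_i`. -/
noncomputable def vnorm {n : ℕ} (x : Fin n → ℝ≥0) : ℝ≥0 :=
  Finset.univ.sup x

/-- The trajectory of the deterministic max-product system `x_{k+1} = A ⊠ x_k`. -/
noncomputable def mpTraj {n : ℕ} (A : Fin n → Fin n → ℝ≥0) (x0 : Fin n → ℝ≥0) :
    ℕ → Fin n → ℝ≥0
  | 0 => x0
  | k + 1 => mpMulVec A (mpTraj A x0 k)

/-- Exponential stability of `x_{k+1} = A ⊠ x_k`. -/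
def ExpStable {n : ℕ} (A : Fin n → Fin n → ℝ≥0) : Prop :=
  ∃ a L : ℝ≥0, 1 < a ∧ 0 < L ∧
    ∀ (x0 : Fin n → ℝ≥0) (k : ℕ), vnorm (mpTraj A x0 k) ≤ L * vnorm x0 / a ^ k

theorem mpMulVec_sup {n m : ℕ} (A : Fin n → Fin m → ℝ≥0) (x y : Fin m → ℝ≥0) :
    mpMulVec A (x ⊔ y) = mpMulVec A x ⊔ mpMulVec A y := by
  funext i
  simp only [mpMulVec, Pi.sup_apply, ← Finset.sup_sup]
  refine Finset.sup_congr rfl fun j _ => ?_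
  exact mul_max _ _ _

theorem vnorm_sup {n : ℕ} (x y : Fin n → ℝ≥0) : vnorm (x ⊔ y) = vnorm x ⊔ vnorm y :=
  Finset.sup_sup

theorem mpTraj_sup {n : ℕ} (A : Fin n → Fin n → ℝ≥0) (x y : Fin n → ℝ≥0) (k : ℕ) :
    mpTraj A (x ⊔ y) k = mpTraj A x k ⊔ mpTraj A y k := by
  induction k with
  | zero => rfl
  | succ k ih => simp only [mpTraj, ih, mpMulVec_sup]

theorem mpTraj_mpMulVec {n : ℕ} (A : Fin n → Fin n → ℝ≥0) (x : Fin n → ℝ≥0) (k : ℕ) :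
    mpTraj A (mpMulVec A x) k = mpTraj A x (k + 1) := by
  induction k with
  | zero => rfl
  | succ k ih => rw [mpTraj, ih, ← mpTraj]

theorem vnorm_mpMulVec_le {n m : ℕ} (A : Fin n → Fin m → ℝ≥0) (x : Fin m → ℝ≥0) :
    vnorm (mpMulVec A x) ≤ vnorm (fun i => vnorm (A i)) * vnorm x := by
  refine Finset.sup_le fun i _ => Finset.sup_le fun j _ => ?_
  refine mul_le_mul' (le_trans ?_ (Finset.le_sup (Finset.mem_univ i)))
    (Finset.le_sup (Finset.mem_univ j))
  exact Finset.le_sup (f := A i) (Finset.mem_univ j)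

/-- An exponentially stable system has uniformly bounded trajectories. -/
theorem ExpStable.exists_vnorm_mpTraj_le {n : ℕ} {A : Fin n → Fin n → ℝ≥0} (hA : ExpStable A) :
    ∃ L : ℝ≥0, ∀ x k, vnorm (mpTraj A x k) ≤ L * vnorm x := by
  obtain ⟨a, L, ha, -, h⟩ := hA
  exact ⟨L, fun x k => (h x k).trans (div_le_self zero_le (one_le_pow₀ ha.le))⟩

/-- If all free trajectories of `A` are bounded, so is every state sequence of
`x_{k+1} = (A ⊠ x_k) ∨ w_k` with bounded disturbance `w`. -/
theorem vnorm_le_of_vnorm_mpTraj_le {n : ℕ} {A : Fin n → Fin n → ℝ≥0} {L M : ℝ≥0}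
    (hL : ∀ x k, vnorm (mpTraj A x k) ≤ L * vnorm x) {x w : ℕ → Fin n → ℝ≥0}
    (hx : ∀ k, x (k + 1) = mpMulVec A (x k) ⊔ w k) (hx0 : vnorm (x 0) ≤ M)
    (hw : ∀ k, vnorm (w k) ≤ M) (k : ℕ) : vnorm (x k) ≤ L * M := by
  have key : ∀ k j, vnorm (mpTraj A (x k) j) ≤ L * M := by
    intro k
    induction k with
    | zero => exact fun j => (hL _ j).trans (by gcongr)
    | succ k ih =>
      intro j
      rw [hx, mpTraj_sup, vnorm_sup, mpTraj_mpMulVec]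
      exact sup_le (ih _) ((hL _ j).trans (mul_le_mul_right (hw k) L))
  exact key k 0

/-- if the free system `x_{k+1} = A ⊠ x_k` is exponentially stable, then the
input–output system `x_{k+1} = (A ⊠ x_k) ∨ (B ⊠ u_k)`, `z_k = (C ⊠ x_k) ∨ (D ⊠ u_k)` is
BIBO stable: every bounded input sequence produces a bounded output sequence,
for every initial condition. -/
theorem bibo_of_expStable {n m q : ℕ} (A : Fin n → Fin n → ℝ≥0) (B : Fin n → Fin m → ℝ≥0)
    (C : Fin q → Fin n → ℝ≥0) (D : Fin q → Fin m → ℝ≥0) (hA : ExpStable A)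
    (x : ℕ → Fin n → ℝ≥0) (u : ℕ → Fin m → ℝ≥0) (z : ℕ → Fin q → ℝ≥0)
    (hx : ∀ k, x (k + 1) = fun i => mpMulVec A (x k) i ⊔ mpMulVec B (u k) i)
    (hz : ∀ k, z k = fun i => mpMulVec C (x k) i ⊔ mpMulVec D (u k) i)
    (hu : ∃ Mu : ℝ≥0, ∀ k, vnorm (u k) ≤ Mu) :
    ∃ Mz : ℝ≥0, ∀ k, vnorm (z k) ≤ Mz := by
  obtain ⟨Mu, hu⟩ := hu
  obtain ⟨L, hL⟩ := hA.exists_vnorm_mpTraj_le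
  have bound : ∀ {p r : ℕ} (E : Fin p → Fin r → ℝ≥0) {v : Fin r → ℝ≥0} {K : ℝ≥0},
      vnorm v ≤ K → vnorm (mpMulVec E v) ≤ vnorm (fun i => vnorm (E i)) * K :=
    fun E _ _ h => (vnorm_mpMulVec_le E _).trans (by gcongr)
  have hxb := vnorm_le_of_vnorm_mpTraj_le hL (w := fun k => mpMulVec B (u k)) hx
    le_sup_left (fun k => (bound B (hu k)).trans le_sup_right)
  refine ⟨vnorm (fun i => vnorm (C i)) * (L * (vnorm (x 0) ⊔ vnorm (fun i => vnorm (B i)) * Mu)) ⊔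
    vnorm (fun i => vnorm (D i)) * Mu, fun k => ?_⟩
  rw [hz k]
  exact (vnorm_sup _ _).trans_le (sup_le_sup (bound C (hxb k)) (bound D (hu k)))
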